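/- Let n ≥ 1, N = 2n+2, 0 < α < 1, and let φ(r) = r^α. Then there is a constant C > 0, depending only on n, α and R*, such that for every j ∈ ℤ, every t ≠ 0, every θ ∈ [0,1] and every (z,s) ∈ ℂ^n × ℝ, the fractional Schrödinger kernel satisfies |F_j^φ(t,z,s)| ≤ C |t|^{−θ/2} 2^{j(N−αθ)}. -/

import Mathlib

open MeasureTheory

/-- Squared Euclidean norm of `z ∈ ℂⁿ`. -/
noncomputable def hnormSq {n : ℕ} (z : Fin n → ℂ) : ℝ := ∑ j, Complex.normSq (z j)

/-- Laguerre polynomial of type `d` and degree `m`. -/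
noncomputable def laguerreL (d m : ℕ) (t : ℝ) : ℝ :=
  ∑ k ∈ Finset.range (m + 1),
    (-1 : ℝ) ^ k * (Nat.choose (m + d) (m - k)) * t ^ k / (Nat.factorial k)

/-- The `m`-th term of the series defining the kernel `F_j^φ(t,z,s)` of the
frequency-localized propagator `e^{itφ(𝓛)}φ_j` on the Heisenberg group. -/
noncomputable def Fterm (n : ℕ) (R φ : ℝ → ℝ) (j : ℤ) (t : ℝ)
    (z : Fin n → ℂ) (s : ℝ) (m : ℕ) : ℂ :=
  ∫ lam : ℝ,
    Complex.exp (-(Complex.I * lam * s)) *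
      Complex.exp (Complex.I * t * (φ (4 * (2 * (m : ℝ) + n) * |lam|) : ℝ)) *
      ((R ((2 : ℝ) ^ (-(2 : ℤ) * j) * (2 * (m : ℝ) + n) * |lam|) *
        laguerreL (n - 1) m (2 * |lam| * hnormSq z) *
        Real.exp (-(|lam| * hnormSq z)) * |lam| ^ n : ℝ) : ℂ)

/-- The kernel `F_j^φ(t,z,s)` of the frequency-localized propagator `e^{itφ(𝓛)}φ_j`
on the Heisenberg group `Hⁿ`. -/
noncomputable def Fkernel (n : ℕ) (R φ : ℝ → ℝ) (j : ℤ) (t : ℝ)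
    (z : Fin n → ℂ) (s : ℝ) : ℂ :=
  (((2 : ℝ) ^ (n - 1) / Real.pi ^ (n + 1) : ℝ) : ℂ) * ∑' m : ℕ, Fterm n R φ j t z s m

lemma aux_vdc (a b l B V : ℝ) (hab : a ≤ b) (hl : 0 < l) (ψ u u' h h' : ℝ → ℝ)
    (hψ : ∀ x ∈ Set.Icc a b, HasDerivAt ψ (u x) x)
    (hu : ∀ x ∈ Set.Icc a b, HasDerivAt u (u' x) x)
    (hu'c : ContinuousOn u' (Set.Icc a b))
    (hh : ∀ x ∈ Set.Icc a b, HasDerivAt h (h' x) x)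
    (hh'c : ContinuousOn h' (Set.Icc a b))
    (σ : ℝ) (hσ : |σ| = 1) (hlb : ∀ x ∈ Set.Icc a b, l ≤ σ * u' x)
    (hB : ∀ x ∈ Set.Icc a b, |h x| ≤ B) (ha : h a = 0) (hb : h b = 0)
    (hV : ∫ x in a..b, |h' x| ≤ V) :
    ‖∫ x in a..b, Complex.exp (Complex.I * ψ x) * h x‖ ≤ (V / 2 + 2 * Real.pi * B) / √l := by
  have hIcc : Set.uIcc a b = Set.Icc a b := Set.uIcc_of_le hab
  set δ := √l with hδ
  have hδ0 : 0 < δ := Real.sqrt_pos.2 hl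
  have hδ2 : δ ^ 2 = l := Real.sq_sqrt hl.le
  have hψc : ContinuousOn ψ (Set.Icc a b) := fun x hx => (hψ x hx).continuousAt.continuousWithinAt
  have huc : ContinuousOn u (Set.Icc a b) := fun x hx => (hu x hx).continuousAt.continuousWithinAt
  have hhc : ContinuousOn h (Set.Icc a b) := fun x hx => (hh x hx).continuousAt.continuousWithinAt
  have hpos : ∀ x, 0 < u x ^ 2 + l := fun x => by positivity
  have hposC : ∀ x, ((u x : ℂ) ^ 2 + l) ≠ 0 := fun x => by
    have := (hpos x).ne'
    exact_mod_cast this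
  -- the primitive
  let G : ℝ → ℂ := fun x => Complex.exp (Complex.I * ψ x) * h x * (u x / (u x ^ 2 + l))
  let G' : ℝ → ℂ := fun x => Complex.exp (Complex.I * ψ x) * (Complex.I * h x)
    - Complex.exp (Complex.I * ψ x) * (Complex.I * h x * (l / (u x ^ 2 + l))
      - h' x * (u x / (u x ^ 2 + l)) - h x * (u' x * (l - u x ^ 2) / (u x ^ 2 + l) ^ 2))
  have hG : ∀ x ∈ Set.uIcc a b, HasDerivAt G (G' x) x := by
    intro x hx
    rw [hIcc] at hx
    have e1 : HasDerivAt (fun x => Complex.exp (Complex.I * ψ x))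
        (Complex.exp (Complex.I * ψ x) * (Complex.I * u x)) x :=
      ((hψ x hx).ofReal_comp.const_mul Complex.I).cexp
    have e2 := (hh x hx).ofReal_comp
    have e3 := (hu x hx).ofReal_comp
    have e4 := e3.div ((e3.pow 2).add_const (l : ℂ)) (hposC x)
    have e5 := (e1.mul e2).mul e4
    refine e5.congr_deriv ?_
    simp only [G', Pi.mul_apply, Pi.div_apply, Pi.pow_apply]
    have := hposC x
    field_simp
    push_cast
    ring
  have hG'c : ContinuousOn G' (Set.uIcc a b) := by
    rw [hIcc]
    have c1 : ContinuousOn (fun x => (ψ x : ℂ)) (Set.Icc a b) := Complex.continuous_ofReal.comp_continuousOn hψc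
    have c2 : ContinuousOn (fun x => (u x : ℂ)) (Set.Icc a b) := Complex.continuous_ofReal.comp_continuousOn huc
    have c3 : ContinuousOn (fun x => (u' x : ℂ)) (Set.Icc a b) := Complex.continuous_ofReal.comp_continuousOn hu'c
    have c4 : ContinuousOn (fun x => (h x : ℂ)) (Set.Icc a b) := Complex.continuous_ofReal.comp_continuousOn hhc
    have c5 : ContinuousOn (fun x => (h' x : ℂ)) (Set.Icc a b) := Complex.continuous_ofReal.comp_continuousOn hh'c
    have c0 : ContinuousOn (fun x => (u x : ℂ) ^ 2 + l) (Set.Icc a b) := by fun_prop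
    have c6 := c2.div c0 (fun x _ => hposC x)
    have c7 := (continuousOn_const (c := (l : ℂ))).div c0 (fun x _ => hposC x)
    have c9 : ContinuousOn (fun x => (u' x : ℂ) * (l - (u x : ℂ) ^ 2)) (Set.Icc a b) := by fun_prop
    have c8 := c9.div (c0.pow 2) (fun x _ => pow_ne_zero 2 (hposC x))
    have cE : ContinuousOn (fun x => Complex.exp (Complex.I * ψ x)) (Set.Icc a b) := by fun_prop
    have cI : ContinuousOn (fun x => Complex.I * (h x : ℂ)) (Set.Icc a b) := by fun_prop
    exact (cE.mul cI).sub (cE.mul (((cI.mul c7).sub (c5.mul c6)).sub (c4.mul c8)))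
  have hint : ∫ x in a..b, G' x = 0 := by
    rw [intervalIntegral.integral_eq_sub_of_hasDerivAt hG hG'c.intervalIntegrable]
    simp [G, ha, hb]
  have hEc : ContinuousOn (fun x => Complex.exp (Complex.I * ψ x) * (Complex.I * h x)) (Set.uIcc a b) := by
    rw [hIcc]
    have c1 : ContinuousOn (fun x => (ψ x : ℂ)) (Set.Icc a b) := Complex.continuous_ofReal.comp_continuousOn hψc
    have c4 : ContinuousOn (fun x => (h x : ℂ)) (Set.Icc a b) := Complex.continuous_ofReal.comp_continuousOn hhc
    fun_prop
  have hkey : Complex.I * ∫ x in a..b, Complex.exp (Complex.I * ψ x) * h x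
      = ∫ x in a..b, (Complex.exp (Complex.I * ψ x) * (Complex.I * h x) - G' x) := by
    rw [intervalIntegral.integral_sub hEc.intervalIntegrable hG'c.intervalIntegrable, hint, sub_zero,
      ← intervalIntegral.integral_const_mul]
    congr 1; ext x; ring
  have hnorm : ‖∫ x in a..b, Complex.exp (Complex.I * ψ x) * h x‖
      = ‖∫ x in a..b, (Complex.exp (Complex.I * ψ x) * (Complex.I * h x) - G' x)‖ := by
    rw [← hkey]; simp
  have hBnn : 0 ≤ B := (abs_nonneg _).trans (hB a ⟨le_rfl, hab⟩)
  have hatan : ∀ x ∈ Set.uIcc a b, HasDerivAt (fun x => σ * (Real.arctan (u x / δ) / δ))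
      (σ * u' x / (u x ^ 2 + l)) x := by
    intro x hx
    rw [hIcc] at hx
    have := ((((hu x hx).div_const δ).arctan).div_const δ).const_mul σ
    refine this.congr_deriv ?_
    have h1 := hpos x
    rw [← hδ2] at h1 ⊢
    field_simp
    ring
  have hMc : ContinuousOn (fun x => σ * u' x / (u x ^ 2 + l)) (Set.uIcc a b) := by
    rw [hIcc]
    fun_prop (disch := intro x _; exact (hpos x).ne')
  have hM : ∫ x in a..b, σ * u' x / (u x ^ 2 + l) ≤ Real.pi / δ := by
    rw [intervalIntegral.integral_eq_sub_of_hasDerivAt hatan hMc.intervalIntegrable]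
    have h1 : |Real.arctan (u b / δ) - Real.arctan (u a / δ)| ≤ Real.pi := by
      rw [abs_le]
      constructor <;> linarith [Real.arctan_lt_pi_div_two (u b / δ), Real.arctan_lt_pi_div_two (u a / δ),
        Real.neg_pi_div_two_lt_arctan (u b / δ), Real.neg_pi_div_two_lt_arctan (u a / δ)]
    have h2 : σ * (Real.arctan (u b / δ) - Real.arctan (u a / δ)) ≤ Real.pi := by
      refine (le_abs_self _).trans ?_
      rw [abs_mul, hσ, one_mul]; exact h1
    calc _ = (σ * (Real.arctan (u b / δ) - Real.arctan (u a / δ))) / δ := by ring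
      _ ≤ _ := by gcongr
  have habs : ContinuousOn (fun x => |h' x|) (Set.uIcc a b) := by rw [hIcc]; exact hh'c.abs
  have hptw : ∀ x ∈ Set.Icc a b, ‖Complex.exp (Complex.I * ψ x) * (Complex.I * h x) - G' x‖
      ≤ 2 * B * (σ * u' x / (u x ^ 2 + l)) + (1 / (2 * δ)) * |h' x| := by
    intro x hx
    have hE : ‖Complex.exp (Complex.I * ψ x)‖ = 1 := by
      rw [mul_comm]; exact Complex.norm_exp_ofReal_mul_I _
    have : Complex.exp (Complex.I * ψ x) * (Complex.I * h x) - G' x =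
      Complex.exp (Complex.I * ψ x) * (Complex.I * ((h x * (l / (u x ^ 2 + l)) : ℝ) : ℂ)
      - ((h' x * (u x / (u x ^ 2 + l)) : ℝ) : ℂ)
      - ((h x * (u' x * (l - u x ^ 2) / (u x ^ 2 + l) ^ 2) : ℝ) : ℂ)) := by
      simp only [G']; push_cast; ring
    rw [this, norm_mul, hE, one_mul]
    have hp := hpos x
    have b1 : ‖Complex.I * ((h x * (l / (u x ^ 2 + l)) : ℝ) : ℂ)‖ ≤ B * (σ * u' x / (u x ^ 2 + l)) := by
      rw [norm_mul, Complex.norm_I, one_mul, Complex.norm_real, Real.norm_eq_abs, abs_mul,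
        abs_of_pos (div_pos hl hp)]
      exact mul_le_mul (hB x hx) (by gcongr; exact hlb x hx) (by positivity) hBnn
    have b2 : ‖((h' x * (u x / (u x ^ 2 + l)) : ℝ) : ℂ)‖ ≤ (1 / (2 * δ)) * |h' x| := by
      rw [Complex.norm_real, Real.norm_eq_abs, abs_mul, mul_comm]
      gcongr
      rw [abs_div, abs_of_pos hp, div_le_div_iff₀ hp (by positivity), ← hδ2]
      nlinarith [sq_nonneg (|u x| - δ), sq_abs (u x)]
    have hu'abs : |u' x| = σ * u' x := by
      rw [← abs_of_pos (hl.trans_le (hlb x hx)), abs_mul, hσ, one_mul]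
    have b3 : ‖((h x * (u' x * (l - u x ^ 2) / (u x ^ 2 + l) ^ 2) : ℝ) : ℂ)‖
        ≤ B * (σ * u' x / (u x ^ 2 + l)) := by
      rw [Complex.norm_real, Real.norm_eq_abs, abs_mul]
      refine mul_le_mul (hB x hx) ?_ (abs_nonneg _) hBnn
      rw [abs_div, abs_mul, hu'abs, abs_of_pos (pow_pos hp 2), sq (u x ^ 2 + l), mul_div_mul_comm]
      refine mul_le_of_le_one_right (div_nonneg (hl.le.trans (hlb x hx)) hp.le) ?_
      rw [div_le_one hp, abs_le]
      constructor <;> nlinarith [sq_nonneg (u x)]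
    refine (norm_sub_le _ _).trans ?_
    have := norm_sub_le (Complex.I * ((h x * (l / (u x ^ 2 + l)) : ℝ) : ℂ)) ((h' x * (u x / (u x ^ 2 + l)) : ℝ) : ℂ)
    linarith
  rw [hnorm]
  refine (intervalIntegral.norm_integral_le_of_norm_le hab (g := fun x => 2 * B * (σ * u' x / (u x ^ 2 + l)) + (1 / (2 * δ)) * |h' x|) ?_ ?_).trans ?_
  · exact Filter.Eventually.of_forall fun x hx => hptw x (Set.Ioc_subset_Icc_self hx)
  · exact ((hMc.intervalIntegrable).const_mul _).add ((habs.intervalIntegrable).const_mul _)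
  · rw [intervalIntegral.integral_add ((hMc.intervalIntegrable).const_mul _) ((habs.intervalIntegrable).const_mul _),
      intervalIntegral.integral_const_mul, intervalIntegral.integral_const_mul]
    calc _ ≤ 2 * B * (Real.pi / δ) + (1 / (2 * δ)) * V := by gcongr
      _ = _ := by field_simp; ring

lemma lag_succ (d m : ℕ) (t : ℝ) :
    laguerreL (d + 1) (m + 1) t = laguerreL (d + 1) m t + laguerreL d (m + 1) t := by
  unfold laguerreL
  rw [Finset.sum_range_succ _ (m + 1),
    Finset.sum_range_succ (fun k => (-1 : ℝ) ^ k * (Nat.choose (m + 1 + d) (m + 1 - k)) * t ^ k /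
      (Nat.factorial k)) (m + 1), ← add_assoc (Finset.sum _ _), ← Finset.sum_add_distrib]
  congr 1
  · refine Finset.sum_congr rfl fun k hk => ?_
    have hk' : k ≤ m := Nat.lt_succ_iff.1 (Finset.mem_range.1 hk)
    rw [show m + 1 + (d + 1) = (m + (d + 1)) + 1 by ring, show m + 1 - k = (m - k) + 1 by omega,
      Nat.choose_succ_succ, show m + 1 + d = m + (d + 1) by ring]
    push_cast
    ring
  · simp

lemma lag_sum (d m : ℕ) (t : ℝ) :
    laguerreL (d + 1) m t = ∑ i ∈ Finset.range (m + 1), laguerreL d i t := by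
  induction m with
  | zero => simp [laguerreL]
  | succ m ih => rw [lag_succ, ih, Finset.sum_range_succ _ (m + 1)]

noncomputable def lagP (m : ℕ) : Polynomial ℝ :=
  ∑ k ∈ Finset.range (m + 1), Polynomial.monomial k ((-1 : ℝ) ^ k * (Nat.choose m k) / (Nat.factorial k))

lemma lagP_coeff (m k : ℕ) : (lagP m).coeff k = (-1 : ℝ) ^ k * (Nat.choose m k) / (Nat.factorial k) := by
  unfold lagP
  simp only [Polynomial.finsetSum_coeff, Polynomial.coeff_monomial]
  rw [Finset.sum_ite_eq' (Finset.range (m+1)) k]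
  split_ifs with h
  · rfl
  · rw [Nat.choose_eq_zero_of_lt (by simpa using h)]; simp

lemma lagP_eval (m : ℕ) (t : ℝ) : (lagP m).eval t = laguerreL 0 m t := by
  unfold lagP laguerreL
  rw [Polynomial.eval_finsetSum]
  refine Finset.sum_congr rfl fun k hk => ?_
  have hk' : k ≤ m := Nat.lt_succ_iff.1 (Finset.mem_range.1 hk)
  rw [Polynomial.eval_monomial, add_zero, Nat.choose_symm hk']
  ring

open Polynomial in
lemma lagP_ode (m : ℕ) : X * derivative (derivative (lagP m)) + (1 - X) * derivative (lagP m)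
    + C (m : ℝ) * lagP m = 0 := by
  ext k
  have h1 : (Nat.choose m (k+1) : ℝ) * (k+1) = Nat.choose m k * (m - k) := by
    rcases le_or_gt k m with h | h
    · have := Nat.choose_succ_right_eq m k
      have h2 : ((m - k : ℕ) : ℝ) = m - k := by push_cast [h]; ring
      rw [← h2]; exact_mod_cast this
    · rw [Nat.choose_eq_zero_of_lt h, Nat.choose_eq_zero_of_lt (by omega)]; simp
  have h2 : ((k+1).factorial : ℝ) = (k+1) * k.factorial := by push_cast [Nat.factorial_succ]; ring
  have h3 : (k.factorial : ℝ) ≠ 0 := by positivity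
  have h4 : (k + 1 : ℝ) ≠ 0 := by positivity
  have key : ((k:ℝ)+1)^2 * (lagP m).coeff (k+1) + ((m:ℝ) - k) * (lagP m).coeff k = 0 := by
    rw [lagP_coeff, lagP_coeff, h2]
    field_simp
    rw [pow_succ]
    linear_combination (-(-1 : ℝ) ^ k) * h1
  rw [sub_mul, one_mul]
  cases k with
  | zero =>
    simp [Polynomial.coeff_derivative] at key ⊢
    linarith
  | succ k =>
    simp [Polynomial.coeff_derivative, Polynomial.coeff_X_mul] at key ⊢
    linarith

lemma alt_sum (m l : ℕ) (hl : l ≤ m) :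
    ∑ k ∈ Finset.range (m + 1), (-1 : ℤ) ^ (m - k) * (m.choose k) * ((l + k).choose l : ℤ)
      = if l = m then 1 else 0 := by
  have := fwdDiff_iter_eq_sum_shift (1 : ℕ) (fun x : ℕ => (x.choose l : ℤ)) m l
  simp only [smul_eq_mul, mul_one] at this
  rw [← this]
  have h2 : (fwdDiff (1:ℕ))^[l] (fun x : ℕ => (x.choose l : ℤ)) = fun x => 1 := by
    simpa using fwdDiff_iter_choose 0 l
  split_ifs with h
  · subst h; rw [h2]
  · obtain ⟨p, rfl⟩ := Nat.exists_eq_add_of_lt (lt_of_le_of_ne hl h)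
    rw [show l + p + 1 = (p + 1) + l by ring, Function.iterate_add_apply, h2, Function.iterate_succ_apply,
      fwdDiff_const]
    have : (fun _ : ℕ => (0:ℤ)) = 0 := rfl
    have h3 : ∀ p, (fwdDiff (1:ℕ))^[p] (0 : ℕ → ℤ) = 0 := by
      intro p
      induction p with
      | zero => rfl
      | succ p ih => rw [Function.iterate_succ_apply]; convert ih using 2; ext; simp [fwdDiff]
    rw [this, h3 p]; rfl

lemma pe_integrable (S : Polynomial ℝ) :
    IntegrableOn (fun x => S.eval x * Real.exp (-x)) (Set.Ioi 0) := by
  induction S using Polynomial.induction_on' with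
  | add p q hp hq =>
    refine (hp.add hq).congr_fun (fun x _ => ?_) measurableSet_Ioi
    simp; ring
  | monomial k a =>
    have := (Real.GammaIntegral_convergent (s := k + 1) (by positivity)).const_mul a
    refine IntegrableOn.congr_fun this (fun x _ => ?_) measurableSet_Ioi
    simp; ring

lemma pe_integral_pow (k : ℕ) :
    ∫ x in Set.Ioi (0:ℝ), x ^ k * Real.exp (-x) = k.factorial := by
  rw [← Real.Gamma_nat_eq_factorial, Real.Gamma_eq_integral (by positivity)]
  refine setIntegral_congr_fun measurableSet_Ioi fun x _ => ?_
  simp; ring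

lemma pe_hasDerivAt (S : Polynomial ℝ) (x : ℝ) :
    HasDerivAt (fun x => S.eval x * Real.exp (-x))
      ((Polynomial.derivative S - S).eval x * Real.exp (-x)) x := by
  have := (S.hasDerivAt x).mul ((hasDerivAt_neg x).exp)
  refine this.congr_deriv ?_
  simp; ring

lemma pe_tendsto (S : Polynomial ℝ) :
    Filter.Tendsto (fun x => S.eval x * Real.exp (-x)) Filter.atTop (nhds 0) := by
  refine (S.tendsto_div_exp_atTop).congr fun x => ?_
  rw [Real.exp_neg]; rfl

lemma pe_integral_deriv (S : Polynomial ℝ) :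
    ∫ x in Set.Ioi (0:ℝ), (Polynomial.derivative S - S).eval x * Real.exp (-x) = - S.eval 0 := by
  rw [integral_Ioi_of_hasDerivAt_of_tendsto (pe_hasDerivAt S 0).continuousAt.continuousWithinAt
    (fun x _ => pe_hasDerivAt S x) (pe_integrable _) (pe_tendsto S)]
  simp

lemma pe_antitone (S : Polynomial ℝ) (h : ∀ x, (Polynomial.derivative S - S).eval x ≤ 0) :
    Antitone (fun x => S.eval x * Real.exp (-x)) := by
  refine antitone_of_deriv_nonpos (fun x => (pe_hasDerivAt S x).differentiableAt) fun x => ?_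
  rw [(pe_hasDerivAt S x).deriv]
  exact mul_nonpos_of_nonpos_of_nonneg (h x) (Real.exp_pos _).le

lemma lagP_norm (m : ℕ) :
    ∫ x in Set.Ioi (0:ℝ), (lagP m ^ 2).eval x * Real.exp (-x) = 1 := by
  set c : ℕ → ℝ := fun k => (-1 : ℝ) ^ k * (Nat.choose m k) / (Nat.factorial k) with hc
  have h1 : ∀ x, (lagP m ^ 2).eval x * Real.exp (-x) =
      ∑ l ∈ Finset.range (m + 1), ∑ k ∈ Finset.range (m + 1), c l * c k * (x ^ (l + k) * Real.exp (-x)) := by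
    intro x
    rw [Polynomial.eval_pow, sq]
    unfold lagP
    rw [Polynomial.eval_finsetSum, Finset.sum_mul_sum, Finset.sum_mul]
    refine Finset.sum_congr rfl fun l _ => ?_
    rw [Finset.sum_mul]
    refine Finset.sum_congr rfl fun k _ => ?_
    simp only [Polynomial.eval_monomial, hc]
    ring
  have hi : ∀ k : ℕ, IntegrableOn (fun x : ℝ => x ^ k * Real.exp (-x)) (Set.Ioi 0) := fun k => by
    simpa using pe_integrable (Polynomial.X ^ k)
  simp_rw [h1]
  rw [integral_finsetSum _ (fun l _ => integrable_finsetSum _ fun k _ => (hi (l+k)).const_mul _)]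
  have h2 : ∀ l ∈ Finset.range (m+1), ∫ x in Set.Ioi (0:ℝ), ∑ k ∈ Finset.range (m + 1), c l * c k * (x ^ (l + k) * Real.exp (-x))
      = if l = m then 1 else 0 := by
    intro l hl
    have hl' : l ≤ m := Nat.lt_succ_iff.1 (Finset.mem_range.1 hl)
    rw [integral_finsetSum _ fun k _ => (hi (l+k)).const_mul _]
    simp_rw [integral_const_mul, pe_integral_pow]
    have h3 : ∑ k ∈ Finset.range (m + 1), c l * c k * ((l + k).factorial : ℝ)
       = (-1) ^ (l + m) * (m.choose l) *
        ((∑ k ∈ Finset.range (m + 1), (-1 : ℤ) ^ (m - k) * (m.choose k) * ((l + k).choose l : ℤ) : ℤ) : ℝ) := by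
      push_cast
      rw [Finset.mul_sum]
      refine Finset.sum_congr rfl fun k hk => ?_
      have hk' : k ≤ m := Nat.lt_succ_iff.1 (Finset.mem_range.1 hk)
      have h4 : ((l + k).factorial : ℝ) = (l + k).choose l * l.factorial * k.factorial := by
        have := Nat.add_choose_mul_factorial_mul_factorial l k
        rw [Nat.choose_symm_add]; exact_mod_cast this.symm
      have h5 : (-1 : ℝ) ^ (l + m) * (-1) ^ (m - k) = (-1) ^ l * (-1) ^ k := by
        obtain ⟨p, rfl⟩ := Nat.exists_eq_add_of_le hk'
        rw [Nat.add_sub_cancel_left, ← pow_add, ← pow_add, show l + (k + p) + p = l + k + 2 * p by ring, pow_add _ (l + k), pow_mul]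
        norm_num
      rw [h4]
      simp only [hc]
      have := (Nat.factorial_pos l).ne'
      have := (Nat.factorial_pos k).ne'
      field_simp
      linear_combination (-(m.choose l : ℝ) * m.choose k * (l + k).choose l) * h5
    rw [h3, alt_sum m l hl']
    split_ifs with h
    · subst h; rw [← two_mul, pow_mul]; simp
    · simp
  rw [Finset.sum_congr rfl h2]
  simp

noncomputable def lagQ (m : ℕ) : Polynomial ℝ := Polynomial.derivative (lagP m) - Polynomial.C (1/2) * lagP m

open Polynomial in
lemma lagP_ode_eval (m : ℕ) (x : ℝ) : x * (derivative (derivative (lagP m))).eval x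
    + (1 - x) * (derivative (lagP m)).eval x + m * (lagP m).eval x = 0 := by
  have := congrArg (Polynomial.eval x) (lagP_ode m)
  simpa using this

open Polynomial in
lemma lag_energy (m : ℕ) :
    IntegrableOn (fun x => (X * lagQ m ^ 2).eval x * Real.exp (-x)) (Set.Ioi 0) ∧
    ∫ x in Set.Ioi (0:ℝ), (X * lagQ m ^ 2).eval x * Real.exp (-x) ≤ m + 1 / 2 := by
  refine ⟨pe_integrable _, ?_⟩
  have h := pe_integral_deriv (X * lagP m * lagQ m)
  have h0 : ∀ x, (derivative (X * lagP m * lagQ m) - X * lagP m * lagQ m).eval x * Real.exp (-x)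
      = (X * lagQ m ^ 2).eval x * Real.exp (-x) - ((C ((m:ℝ) + 1/2) - C (1/4) * X) * lagP m ^ 2).eval x * Real.exp (-x) := by
    intro x
    rw [← sub_mul]
    congr 1
    simp [lagQ]
    linear_combination (lagP m).eval x * lagP_ode_eval m x
  simp_rw [h0] at h
  rw [integral_sub (pe_integrable _) (pe_integrable _)] at h
  have h3 : ∫ x in Set.Ioi (0:ℝ), ((C ((m:ℝ) + 1/2) - C (1/4) * X) * lagP m ^ 2).eval x * Real.exp (-x)
     ≤ ∫ x in Set.Ioi (0:ℝ), ((m:ℝ) + 1/2) * ((lagP m ^ 2).eval x * Real.exp (-x)) := by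
    refine setIntegral_mono_on (pe_integrable _) ((pe_integrable _).const_mul _) measurableSet_Ioi fun x hx => ?_
    rw [← mul_assoc]
    refine mul_le_mul_of_nonneg_right ?_ (Real.exp_pos _).le
    have hx : 0 < x := hx
    simp only [eval_mul, eval_sub, eval_C, eval_X, eval_pow]
    refine mul_le_mul_of_nonneg_right ?_ (sq_nonneg _)
    linarith
  rw [integral_const_mul, lagP_norm] at h3
  simp at h
  simp at h3 ⊢
  linarith

open Polynomial in
lemma lag_sup (m : ℕ) (x : ℝ) (hx : 0 ≤ x) :
    (lagP m).eval x ^ 2 * Real.exp (-x) ≤ 2 * m + 1 := by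
  have a1 := pe_antitone (C 2 * (X * lagQ m ^ 2 + (C ((m:ℝ) + 1/2) - C (1/4) * X) * lagP m ^ 2) - lagP m ^ 2) (by
    intro y
    have : (derivative (C 2 * (X * lagQ m ^ 2 + (C ((m:ℝ) + 1/2) - C (1/4) * X) * lagP m ^ 2) - lagP m ^ 2) - (C 2 * (X * lagQ m ^ 2 + (C ((m:ℝ) + 1/2) - C (1/4) * X) * lagP m ^ 2) - lagP m ^ 2)).eval y
      = - 2 * ((derivative (lagP m)).eval y) ^ 2 := by
      simp [lagQ, derivative_pow]
      linear_combination 4 * ((derivative (lagP m)).eval y - 1 / 2 * (lagP m).eval y) * lagP_ode_eval m y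
    rw [this]
    nlinarith [sq_nonneg ((derivative (lagP m)).eval y)])
  have a2 := pe_antitone (X * lagQ m ^ 2 + (C ((m:ℝ) + 1/2) - C (1/4) * X) * lagP m ^ 2) (by
    intro y
    have : (derivative (X * lagQ m ^ 2 + (C ((m:ℝ) + 1/2) - C (1/4) * X) * lagP m ^ 2) - (X * lagQ m ^ 2 + (C ((m:ℝ) + 1/2) - C (1/4) * X) * lagP m ^ 2)).eval y
      = - (((lagQ m).eval y) ^ 2 + ((lagP m).eval y) ^ 2 / 4) := by
      simp [lagQ, derivative_pow]
      linear_combination 2 * ((derivative (lagP m)).eval y - 1 / 2 * (lagP m).eval y) * lagP_ode_eval m y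
    rw [this]
    nlinarith [sq_nonneg ((lagQ m).eval y), sq_nonneg ((lagP m).eval y)])
  have b1 := a1.le_of_tendsto (pe_tendsto _) x
  have b2 := a2 hx
  have p0 : (lagP m).eval 0 = 1 := by
    rw [← coeff_zero_eq_eval_zero, lagP_coeff]; simp
  simp only [eval_mul, eval_sub, eval_C, eval_X, eval_pow, eval_add, p0] at b1 b2
  simp at b2
  nlinarith

def GoodF (F : ℝ → ℝ) (A : ℝ) : Prop :=
  ContDiff ℝ 1 F ∧ (∀ x, 0 ≤ x → |F x| ≤ A) ∧
    ∀ c : ℝ, 0 ≤ c → ∫ μ in (1/4 : ℝ)..8, |c * deriv F (c * μ)| ≤ A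

lemma lagf_hasDerivAt (m : ℕ) (x : ℝ) :
    HasDerivAt (fun x => laguerreL 0 m x * Real.exp (-x / 2))
      ((lagQ m).eval x * Real.exp (-x / 2)) x := by
  have h : (fun x => laguerreL 0 m x * Real.exp (-x / 2)) =
    fun x => (lagP m).eval x * Real.exp (-x / 2) := by
    ext x; rw [lagP_eval]
  rw [h]
  have := ((lagP m).hasDerivAt x).mul (((hasDerivAt_neg x).div_const 2).exp)
  refine this.congr_deriv ?_
  simp [lagQ]; ring

lemma exp_half_sq (x : ℝ) : Real.exp (-x / 2) ^ 2 = Real.exp (-x) := by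
  rw [← Real.exp_nat_mul]; congr 1; push_cast; ring

lemma good_zero (m : ℕ) :
    GoodF (fun x => laguerreL 0 m x * Real.exp (-x / 2)) (17 * √(2 * m + 1)) := by
  set K := √(2 * (m:ℝ) + 1) with hK
  have hK0 : 0 < K := Real.sqrt_pos.2 (by positivity)
  have hK2 : K ^ 2 = 2 * m + 1 := Real.sq_sqrt (by positivity)
  refine ⟨?_, ?_, ?_⟩
  · unfold laguerreL; fun_prop
  · intro x hx
    have h := lag_sup m x hx
    have h2 : |laguerreL 0 m x * Real.exp (-x / 2)| ≤ K := by
      refine Real.le_sqrt_of_sq_le ?_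
      rw [sq_abs, mul_pow, exp_half_sq, ← lagP_eval]
      exact h
    linarith
  · intro c hc
    have hd : deriv (fun x => laguerreL 0 m x * Real.exp (-x / 2)) =
        fun x => (lagQ m).eval x * Real.exp (-x / 2) := by
      ext x; exact (lagf_hasDerivAt m x).deriv
    rw [hd]
    let g : ℝ → ℝ := fun x => (Polynomial.X * lagQ m ^ 2).eval x * Real.exp (-x)
    have hgc : Continuous g := by simp only [g]; fun_prop
    have hg0 : ∀ x, 0 < x → 0 ≤ g x := fun x hx => by
      simp only [g, Polynomial.eval_mul, Polynomial.eval_X, Polynomial.eval_pow]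
      positivity
    have hgi : c * ∫ μ in (1/4 : ℝ)..8, g (c * μ) ≤ m + 1 / 2 := by
      rw [intervalIntegral.mul_integral_comp_mul_left, intervalIntegral.integral_of_le (by nlinarith)]
      refine le_trans (setIntegral_mono_set (lag_energy m).1 ?_ ?_) (lag_energy m).2
      · exact (ae_restrict_iff' measurableSet_Ioi).2 (Filter.Eventually.of_forall fun x hx => hg0 x hx)
      · refine Filter.Eventually.of_forall fun x hx => ?_
        have hx1 : c * (1/4) < x := hx.1
        show 0 < x
        nlinarith
    have hpt : ∀ μ ∈ Set.Icc (1/4 : ℝ) 8, |c * ((lagQ m).eval (c * μ) * Real.exp (-(c * μ) / 2))|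
        ≤ (1 / (2 * K)) * (c * g (c * μ)) + 2 * K := by
      intro μ hμ
      set w := c * ((lagQ m).eval (c * μ) * Real.exp (-(c * μ) / 2)) with hw
      have e : c * g (c * μ) = μ * |w| ^ 2 := by
        rw [sq_abs, hw, mul_pow, mul_pow, exp_half_sq]
        simp only [g, Polynomial.eval_mul, Polynomial.eval_X, Polynomial.eval_pow]
        ring
      rw [e]
      have h1 : (1/4) * |w| ^ 2 ≤ μ * |w| ^ 2 := by gcongr; exact hμ.1
      have h2 : (1 / (2 * K)) * ((1/4) * |w| ^ 2) + 2 * K - |w| = (|w| - 4 * K) ^ 2 / (8 * K) := by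
        field_simp; ring
      have h3 : 0 ≤ (|w| - 4 * K) ^ 2 / (8 * K) := by positivity
      have h4 : (1 / (2 * K)) * ((1/4) * |w| ^ 2) ≤ (1 / (2 * K)) * (μ * |w| ^ 2) := by gcongr
      linarith
    have hc1 : Continuous fun μ : ℝ => |c * ((lagQ m).eval (c * μ) * Real.exp (-(c * μ) / 2))| := by fun_prop
    have hc2 : Continuous fun μ : ℝ => (1 / (2 * K)) * (c * g (c * μ)) := by fun_prop
    refine (intervalIntegral.integral_mono_on (by norm_num) (hc1.intervalIntegrable _ _)
      ((hc2.add continuous_const).intervalIntegrable _ _) hpt).trans ?_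
    simp only [Pi.add_apply]
    rw [intervalIntegral.integral_add (hc2.intervalIntegrable _ _) intervalIntegrable_const,
      intervalIntegral.integral_const_mul, intervalIntegral.integral_const_mul, intervalIntegral.integral_const]
    have : (1 / (2 * K)) * (c * ∫ μ in (1/4 : ℝ)..8, g (c * μ)) ≤ (1 / (2 * K)) * (K ^ 2 / 2) := by
      gcongr; rw [hK2]; linarith
    have h5 : (1 / (2 * K)) * (K ^ 2 / 2) = K / 4 := by field_simp; ring
    simp only [smul_eq_mul]
    linarith

lemma good_sum (N : ℕ) (F : ℕ → ℝ → ℝ) (A : ℝ) (h : ∀ i < N, GoodF (F i) A) :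
    GoodF (fun x => ∑ i ∈ Finset.range N, F i x) (N * A) := by
  have hN : (N * A : ℝ) = ∑ i ∈ Finset.range N, A := by simp
  refine ⟨ContDiff.sum fun i hi => (h i (Finset.mem_range.1 hi)).1, ?_, ?_⟩
  · intro x hx
    rw [hN]
    exact (Finset.abs_sum_le_sum_abs _ _).trans
      (Finset.sum_le_sum fun i hi => (h i (Finset.mem_range.1 hi)).2.1 x hx)
  · intro c hc
    have hd : deriv (fun x => ∑ i ∈ Finset.range N, F i x) = fun x => ∑ i ∈ Finset.range N, deriv (F i) x := by
      ext x
      exact deriv_fun_sum fun i hi => ((h i (Finset.mem_range.1 hi)).1.differentiable one_ne_zero).differentiableAt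
    have hcont : ∀ i ∈ Finset.range N, Continuous fun μ => |c * deriv (F i) (c * μ)| := fun i hi => by
      have := (h i (Finset.mem_range.1 hi)).1.continuous_deriv_one
      fun_prop
    rw [hN, hd]
    calc _ ≤ ∫ μ in (1/4 : ℝ)..8, ∑ i ∈ Finset.range N, |c * deriv (F i) (c * μ)| := by
          refine intervalIntegral.integral_mono_on (by norm_num) (Continuous.intervalIntegrable ?_ _ _)
            (Continuous.intervalIntegrable (continuous_finsetSum _ hcont) _ _) ?_
          · refine (continuous_const.mul (continuous_finsetSum _ fun i hi => ?_)).abs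
            have := (h i (Finset.mem_range.1 hi)).1.continuous_deriv_one
            fun_prop
          · intro μ _
            rw [Finset.mul_sum]
            exact Finset.abs_sum_le_sum_abs _ _
      _ = ∑ i ∈ Finset.range N, ∫ μ in (1/4 : ℝ)..8, |c * deriv (F i) (c * μ)| :=
          intervalIntegral.integral_finsetSum fun i hi => (hcont i hi).intervalIntegrable _ _
      _ ≤ _ := Finset.sum_le_sum fun i hi => (h i (Finset.mem_range.1 hi)).2.2 c hc

lemma GoodF.mono {F : ℝ → ℝ} {A B : ℝ} (h : GoodF F A) (hAB : A ≤ B) : GoodF F B :=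
  ⟨h.1, fun x hx => (h.2.1 x hx).trans hAB, fun c hc => (h.2.2 c hc).trans hAB⟩

lemma good_lag (d m : ℕ) :
    GoodF (fun x => laguerreL d m x * Real.exp (-x / 2)) (17 * ((m:ℝ) + 1) ^ d * √(2 * m + 1)) := by
  induction d generalizing m with
  | zero => simpa using good_zero m
  | succ d ih =>
    have h1 : (fun x => laguerreL (d + 1) m x * Real.exp (-x / 2)) =
      fun x => ∑ i ∈ Finset.range (m + 1), laguerreL d i x * Real.exp (-x / 2) := by
      ext x; rw [lag_sum, Finset.sum_mul]
    rw [h1]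
    have := good_sum (m + 1) (fun i x => laguerreL d i x * Real.exp (-x / 2)) (17 * ((m:ℝ) + 1) ^ d * √(2 * m + 1)) (by
      intro i hi
      refine (ih i).mono ?_
      have : (i : ℝ) ≤ m := by exact_mod_cast Nat.lt_succ_iff.1 hi
      gcongr)
    convert this using 1
    push_cast; ring

lemma half_bound (n : ℕ) (α : ℝ) (hα0 : 0 < α) (hα1 : α < 1)
    (R : ℝ → ℝ) (hRsm : ContDiff ℝ (⊤ : ℕ∞) R)
    (hRsupp : ∀ τ, R τ ≠ 0 → 1 / 2 ≤ |τ| ∧ |τ| ≤ 4) :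
    ∃ K : ℝ, 0 < K ∧ ∀ (F : ℝ → ℝ) (A : ℝ), GoodF F A → ∀ c s T : ℝ, 0 ≤ c → T ≠ 0 →
      ‖∫ x in (1/4 : ℝ)..8, Complex.exp (Complex.I * ((s * x + T * x ^ α : ℝ) : ℂ)) *
        ((R x * F (c * x) * x ^ n : ℝ) : ℂ)‖ ≤ K * A * min 1 (1 / √|T|) := by
  have hR1 : ContDiff ℝ 1 R := hRsm.of_le (by exact_mod_cast le_top)
  have hRc : Continuous R := hR1.continuous
  have hR'c : Continuous (deriv R) := hR1.continuous_deriv_one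
  obtain ⟨r0, hr0⟩ := isCompact_Icc.exists_bound_of_continuousOn (s := Set.Icc (1/4:ℝ) 8) hRc.continuousOn
  obtain ⟨r1, hr1⟩ := isCompact_Icc.exists_bound_of_continuousOn (s := Set.Icc (1/4:ℝ) 8) hR'c.continuousOn
  have m0 : (1/4:ℝ) ∈ Set.Icc (1/4:ℝ) 8 := by norm_num
  have hr00 : 0 ≤ r0 := (norm_nonneg _).trans (hr0 _ m0)
  have hr10 : 0 ≤ r1 := (norm_nonneg _).trans (hr1 _ m0)
  set c0 : ℝ := α * (1 - α) * 8 ^ (α - 2) with hc0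
  have hc0p : 0 < c0 := by have : 0 < 1 - α := by linarith
                           positivity
  set B0 : ℝ := r0 * 8 ^ n with hB0
  set V0 : ℝ := 8 ^ n * (8 * r1 + r0 + 8 * r0 * n) with hV0
  have hB0p : 0 ≤ B0 := by positivity
  have hV0p : 0 ≤ V0 := by positivity
  refine ⟨(V0 / 2 + 2 * Real.pi * B0) / √c0 + 8 * B0 + 1, by positivity, ?_⟩
  intro F A hF c s T hc hT
  have hA : 0 ≤ A := (abs_nonneg _).trans (hF.2.1 0 le_rfl)
  have hFc : Continuous F := hF.1.continuous
  have hF'c : Continuous (deriv F) := hF.1.continuous_deriv_one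
  have hB : ∀ x ∈ Set.Icc (1/4:ℝ) 8, |R x * F (c * x) * x ^ n| ≤ B0 * A := by
    intro x hx
    have hx0 : 0 ≤ x := by linarith [hx.1]
    rw [abs_mul, abs_mul, abs_of_nonneg (pow_nonneg hx0 n)]
    calc _ ≤ r0 * A * 8 ^ n := by
          gcongr
          · exact hr0 x hx
          · exact hF.2.1 _ (by positivity)
          · exact hx.2
      _ = _ := by rw [hB0]; ring
  have hone : ∀ x : ℝ, ‖Complex.exp (Complex.I * ((s * x + T * x ^ α : ℝ) : ℂ))‖ = 1 := fun x => by
    rw [mul_comm]; exact Complex.norm_exp_ofReal_mul_I _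
  have first : ‖∫ x in (1/4 : ℝ)..8, Complex.exp (Complex.I * ((s * x + T * x ^ α : ℝ) : ℂ)) *
        ((R x * F (c * x) * x ^ n : ℝ) : ℂ)‖ ≤ 8 * B0 * A := by
    refine (intervalIntegral.norm_integral_le_of_norm_le_const (C := B0 * A) ?_).trans ?_
    · intro x hx
      rw [Set.uIoc_of_le (by norm_num)] at hx
      rw [norm_mul, hone, one_mul, Complex.norm_real]
      exact hB x (Set.Ioc_subset_Icc_self hx)
    · have : 0 ≤ B0 * A := by positivity
      rw [abs_of_pos (by norm_num)]; linarith
  have hTp : 0 < |T| := abs_pos.2 hT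
  have second : ‖∫ x in (1/4 : ℝ)..8, Complex.exp (Complex.I * ((s * x + T * x ^ α : ℝ) : ℂ)) *
        ((R x * F (c * x) * x ^ n : ℝ) : ℂ)‖ ≤ (V0 * A / 2 + 2 * Real.pi * (B0 * A)) / √(|T| * c0) := by
    have hRz : ∀ x, 0 ≤ x → (x < 1/2 ∨ 4 < x) → R x = 0 := by
      intro x hx0 hx
      by_contra hne
      have := hRsupp x hne
      rw [abs_of_nonneg hx0] at this
      rcases hx with h | h <;> linarith [this.1, this.2]
    have hh' : Continuous fun x => (deriv R x * F (c * x) + R x * (c * deriv F (c * x))) * x ^ n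
        + R x * F (c * x) * (n * x ^ (n - 1)) := by fun_prop
    refine aux_vdc (1/4) 8 (|T| * c0) (B0 * A) (V0 * A) (by norm_num) (by positivity)
      (fun x => s * x + T * x ^ α) (fun x => s + T * (α * x ^ (α - 1)))
      (fun x => T * (α * ((α - 1) * x ^ (α - 1 - 1))))
      (fun x => R x * F (c * x) * x ^ n)
      (fun x => (deriv R x * F (c * x) + R x * (c * deriv F (c * x))) * x ^ n
        + R x * F (c * x) * (n * x ^ (n - 1))) ?_ ?_ ?_ ?_ hh'.continuousOn (-(SignType.sign T : ℝ)) ?_ ?_ hB ?_ ?_ ?_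
    · intro x hx
      have hx0 : x ≠ 0 := by linarith [hx.1]
      have := ((hasDerivAt_id x).const_mul s).add ((Real.hasDerivAt_rpow_const (p := α) (Or.inl hx0)).const_mul T)
      exact this.congr_deriv (by ring)
    · intro x hx
      have hx0 : x ≠ 0 := by linarith [hx.1]
      exact (((Real.hasDerivAt_rpow_const (p := α - 1) (Or.inl hx0)).const_mul α).const_mul T).const_add s
    · have : ContinuousOn (fun x : ℝ => x ^ (α - 1 - 1)) (Set.Icc (1/4) 8) := by
        intro x hx
        exact (Real.continuousAt_rpow_const x _ (Or.inl (by linarith [hx.1]))).continuousWithinAt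
      fun_prop
    · intro x hx
      have e1 : HasDerivAt R (deriv R x) x := (hR1.differentiable one_ne_zero x).hasDerivAt
      have e2 : HasDerivAt F (deriv F (c * x)) (c * x) := (hF.1.differentiable one_ne_zero _).hasDerivAt
      have e3 : HasDerivAt (fun x => F (c * x)) (deriv F (c * x) * (c * 1)) x :=
        HasDerivAt.comp x e2 ((hasDerivAt_id x).const_mul c)
      have e4 := (e1.mul e3).mul (hasDerivAt_pow n x)
      refine e4.congr_deriv ?_
      simp only [Pi.mul_apply]
      ring
    · rcases lt_or_gt_of_ne hT with h | h <;> simp [h]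
    · intro x hx
      have hx0 : 0 < x := by linarith [hx.1]
      have e : -(SignType.sign T : ℝ) * (T * (α * ((α - 1) * x ^ (α - 1 - 1)))) = |T| * (α * (1 - α) * x ^ (α - 2)) := by
        have : (SignType.sign T : ℝ) * T = |T| := by
          rcases lt_or_gt_of_ne hT with h | h
          · simp [h, abs_of_neg]
          · simp [h, abs_of_pos]
        rw [← this, show α - 1 - 1 = α - 2 by ring]; ring
      rw [e, hc0]
      have : 0 < 1 - α := by linarith
      gcongr ?_ * (?_ * ?_)
      exact Real.rpow_le_rpow_of_nonpos hx0 hx.2 (by linarith)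
    · simp only [hRz (1/4) (by norm_num) (Or.inl (by norm_num)), zero_mul]
    · simp [hRz 8 (by norm_num) (Or.inr (by norm_num))]
    · have hw : Continuous fun x => |c * deriv F (c * x)| := by fun_prop
      have hpt : ∀ x ∈ Set.Icc (1/4:ℝ) 8, |(deriv R x * F (c * x) + R x * (c * deriv F (c * x))) * x ^ n
        + R x * F (c * x) * (n * x ^ (n - 1))| ≤ (r0 * 8 ^ n) * |c * deriv F (c * x)| + (r1 * A * 8 ^ n + r0 * A * (n * 8 ^ n)) := by
        intro x hx
        have hx0 : 0 ≤ x := by linarith [hx.1]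
        have g0 : |R x| ≤ r0 := hr0 x hx
        have g1 : |deriv R x| ≤ r1 := hr1 x hx
        have g2 : |F (c * x)| ≤ A := hF.2.1 _ (by positivity)
        have g3 : x ^ n ≤ 8 ^ n := pow_le_pow_left₀ hx0 hx.2 n
        have g4 : x ^ (n - 1) ≤ 8 ^ n := (pow_le_pow_left₀ hx0 hx.2 _).trans
          (pow_le_pow_right₀ (by norm_num) (Nat.sub_le _ _))
        have t1 : |deriv R x * F (c * x) * x ^ n| ≤ r1 * A * 8 ^ n := by
          rw [abs_mul, abs_mul, abs_of_nonneg (pow_nonneg hx0 n)]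
          gcongr
        have t2 : |R x * (c * deriv F (c * x)) * x ^ n| ≤ (r0 * 8 ^ n) * |c * deriv F (c * x)| := by
          rw [abs_mul, abs_mul (R x), abs_of_nonneg (pow_nonneg hx0 n), mul_right_comm]
          gcongr
        have t3 : |R x * F (c * x) * (n * x ^ (n - 1))| ≤ r0 * A * (n * 8 ^ n) := by
          rw [abs_mul, abs_mul (R x), abs_of_nonneg (by positivity : 0 ≤ (n:ℝ) * x ^ (n - 1))]
          gcongr
        rw [add_mul]
        refine (abs_add_le _ _).trans ?_
        have := abs_add_le (deriv R x * F (c * x) * x ^ n) (R x * (c * deriv F (c * x)) * x ^ n)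
        linarith
      refine (intervalIntegral.integral_mono_on (by norm_num) (hh'.abs.intervalIntegrable _ _)
        (((hw.intervalIntegrable _ _).const_mul _).add intervalIntegrable_const) hpt).trans ?_
      rw [intervalIntegral.integral_add ((hw.intervalIntegrable _ _).const_mul _) intervalIntegrable_const,
        intervalIntegral.integral_const_mul, intervalIntegral.integral_const, smul_eq_mul]
      have k1 : (r0 * 8 ^ n) * ∫ μ in (1/4 : ℝ)..8, |c * deriv F (c * μ)| ≤ (r0 * 8 ^ n) * A := by
        gcongr; exact hF.2.2 c hc
      have k2 : 0 ≤ (r1 * A * 8 ^ n + r0 * A * (n * 8 ^ n)) := by positivity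
      calc _ ≤ (r0 * 8 ^ n) * A + 8 * (r1 * A * 8 ^ n + r0 * A * (n * 8 ^ n)) := by
            gcongr; norm_num
        _ = _ := by rw [hV0]; ring
  have hTs : 0 < √|T| := Real.sqrt_pos.2 hTp
  have hcs : 0 < √c0 := Real.sqrt_pos.2 hc0p
  rcases min_choice 1 (1 / √|T|) with h | h
  · rw [h]
    refine first.trans ?_
    rw [mul_one]
    gcongr
    have : 0 ≤ (V0 / 2 + 2 * Real.pi * B0) / √c0 := by positivity
    linarith
  · rw [h]
    refine second.trans ?_
    rw [Real.sqrt_mul hTp.le]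
    calc _ = (V0 / 2 + 2 * Real.pi * B0) / √c0 * A * (1 / √|T|) := by field_simp
      _ ≤ _ := by
        gcongr
        linarith

lemma fterm_bound (n : ℕ) (hn : 1 ≤ n) (α : ℝ) (hα0 : 0 < α) (hα1 : α < 1)
    (R : ℝ → ℝ) (hRsm : ContDiff ℝ (⊤ : ℕ∞) R)
    (hRev : ∀ τ, R (-τ) = R τ)
    (hRsupp : ∀ τ, R τ ≠ 0 → 1 / 2 ≤ |τ| ∧ |τ| ≤ 4) :
    ∃ K : ℝ, 0 < K ∧ ∀ (j : ℤ) (t : ℝ), t ≠ 0 → ∀ (z : Fin n → ℂ) (s : ℝ) (m : ℕ),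
      ‖Fterm n R (fun r => r ^ α) j t z s m‖ ≤
        K * ((2:ℝ) ^ (2 * j) / (2 * (m:ℝ) + n)) ^ (n + 1) * (17 * ((m:ℝ) + 1) ^ (n - 1) * √(2 * m + 1)) *
          min 1 (1 / √|t * (4 * (2:ℝ) ^ (2 * j)) ^ α|) := by
  obtain ⟨K, hK, hb⟩ := half_bound n α hα0 hα1 R hRsm hRsupp
  refine ⟨2 * K, by positivity, ?_⟩
  intro j t ht z s m
  have hn' : (1:ℝ) ≤ n := by exact_mod_cast hn
  set M : ℝ := 2 * (m:ℝ) + n with hM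
  have hMp : 0 < M := by positivity
  set E : ℝ := (2:ℝ) ^ (2 * j) with hE
  have hEp : 0 < E := by positivity
  set κ : ℝ := E / M with hκ
  have hκp : 0 < κ := by positivity
  have hκM : M * κ = E := by rw [hκ]; field_simp
  set T : ℝ := t * (4 * E) ^ α with hT
  have hT0 : T ≠ 0 := mul_ne_zero ht (by positivity)
  have hz : 0 ≤ hnormSq z := Finset.sum_nonneg fun i _ => Complex.normSq_nonneg _
  set c : ℝ := 2 * κ * hnormSq z with hc
  have hc0 : 0 ≤ c := by positivity
  set A : ℝ := 17 * ((m:ℝ) + 1) ^ (n - 1) * √(2 * m + 1) with hA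
  set F : ℝ → ℝ := fun x => laguerreL (n - 1) m x * Real.exp (-x / 2) with hF
  have hgood : GoodF F A := good_lag (n - 1) m
  let H : ℝ → ℝ → ℂ := fun σ x => Complex.exp (Complex.I * ((σ * x + T * x ^ α : ℝ) : ℂ)) *
        ((R x * F (c * x) * x ^ n : ℝ) : ℂ)
  have hHb : ∀ σ, ‖∫ x in (1/4:ℝ)..8, H σ x‖ ≤ K * A * min 1 (1 / √|T|) := fun σ =>
    hb F A hgood c σ T hc0 hT0
  -- the rescaled integrand
  let G : ℝ → ℂ := fun μ => (κ ^ n : ℝ) * (Complex.exp (Complex.I * ((-(κ * s) * μ + T * |μ| ^ α : ℝ) : ℂ)) *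
        ((R |μ| * F (c * |μ|) * |μ| ^ n : ℝ) : ℂ))
  have hRabs : ∀ x, R |x| = R x := fun x => by
    rcases abs_choice x with h | h <;> rw [h]
    exact hRev x
  have hFt : Fterm n R (fun r => r ^ α) j t z s m = κ * ∫ μ, G μ := by
    unfold Fterm
    have hcv := Measure.integral_comp_mul_left (fun lam : ℝ => Complex.exp (-(Complex.I * lam * s)) *
      Complex.exp (Complex.I * t * (((4 * (2 * (m : ℝ) + n) * |lam|) ^ α : ℝ) : ℂ)) *
      ((R ((2 : ℝ) ^ (-(2 : ℤ) * j) * (2 * (m : ℝ) + n) * |lam|) *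
        laguerreL (n - 1) m (2 * |lam| * hnormSq z) *
        Real.exp (-(|lam| * hnormSq z)) * |lam| ^ n : ℝ) : ℂ)) κ
    rw [abs_of_pos (inv_pos.2 hκp)] at hcv
    have hcv2 : ∀ (a b : ℂ), a = κ⁻¹ • b → b = κ * a := by
      intro a b h
      have : (κ : ℂ) ≠ 0 := by exact_mod_cast hκp.ne'
      rw [h, Complex.real_smul]; push_cast; field_simp
    rw [hcv2 _ _ hcv]
    congr 2
    ext μ
    simp only [G]
    rw [abs_mul, abs_of_pos hκp, ← Complex.exp_add]
    have i1 : (4 * (2 * (m:ℝ) + n) * (κ * |μ|)) ^ α = (4 * E) ^ α * |μ| ^ α := by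
      rw [← Real.mul_rpow (by positivity) (abs_nonneg _), ← hκM, ← hM]; congr 1; ring
    have i2 : (2 : ℝ) ^ (-(2 : ℤ) * j) * (2 * (m : ℝ) + n) * (κ * |μ|) = |μ| := by
      have : (2 : ℝ) ^ (-(2 : ℤ) * j) * E = 1 := by
        rw [hE, ← zpow_add₀ (by norm_num)]; simp
      calc _ = ((2 : ℝ) ^ (-(2 : ℤ) * j) * (M * κ)) * |μ| := by rw [hM]; ring
        _ = _ := by rw [hκM, this, one_mul]
    have i3 : 2 * (κ * |μ|) * hnormSq z = c * |μ| := by rw [hc]; ring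
    have i4 : -(κ * |μ| * hnormSq z) = -(c * |μ|) / 2 := by rw [hc]; ring
    rw [i1, i2, i3, i4]
    simp only [hF, hT]
    rw [mul_left_comm]
    congr 1
    · congr 1; push_cast; ring
    · push_cast; ring
  have hGc : Continuous G := by
    have h1 : Continuous fun μ : ℝ => |μ| ^ α := continuous_abs.rpow_const fun x => Or.inr hα0.le
    have h2 : Continuous R := hRsm.continuous
    have h3 : Continuous F := hgood.1.continuous
    simp only [G]
    fun_prop
  have hGs : HasCompactSupport G := by
    refine HasCompactSupport.intro (isCompact_Icc (a := (-4:ℝ)) (b := 4)) fun x hx => ?_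
    have : R |x| = 0 := by
      by_contra hne
      have := (hRsupp _ hne).2
      rw [abs_abs] at this
      exact hx (abs_le.1 this)
    simp [G, this]
  have hGi : Integrable G := hGc.integrable_of_hasCompactSupport hGs
  have hHz : ∀ σ, ∀ x ∈ Set.Ioi (0:ℝ) \ Set.Ioc (1/4:ℝ) 8, H σ x = 0 := by
    intro σ x hx
    have hx0 : 0 < x := hx.1
    have : R x = 0 := by
      by_contra hne
      have h := hRsupp _ hne
      rw [abs_of_pos hx0] at h
      exact hx.2 ⟨by linarith [h.1], by linarith [h.2]⟩
    simp [H, this]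
  have hHI : ∀ σ, ∫ x in Set.Ioi (0:ℝ), H σ x = ∫ x in (1/4:ℝ)..8, H σ x := by
    intro σ
    rw [intervalIntegral.integral_of_le (by norm_num)]
    exact setIntegral_eq_of_subset_of_forall_diff_eq_zero measurableSet_Ioi
      (fun x hx => lt_trans (by norm_num) hx.1) (hHz σ)
  have hsplit : ∫ μ, G μ = (κ ^ n : ℝ) * ((∫ x in (1/4:ℝ)..8, H (κ * s) x) + ∫ x in (1/4:ℝ)..8, H (-(κ * s)) x) := by
    rw [← intervalIntegral.integral_Iic_add_Ioi (b := (0:ℝ)) hGi.integrableOn hGi.integrableOn]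
    have e1 : ∫ x in Set.Iic (0:ℝ), G x = ∫ x in Set.Ioi (0:ℝ), G (-x) := by
      rw [integral_comp_neg_Ioi]; simp
    rw [e1, ← hHI, ← hHI, mul_add, ← integral_const_mul, ← integral_const_mul]
    congr 1
    · refine setIntegral_congr_fun measurableSet_Ioi fun x hx => ?_
      have hx0 : 0 < x := hx
      simp only [G, H, abs_neg, abs_of_pos hx0]
      congr 5; ring
    · refine setIntegral_congr_fun measurableSet_Ioi fun x hx => ?_
      have hx0 : 0 < x := hx
      simp only [G, H, abs_of_pos hx0]
  rw [hFt, hsplit, norm_mul, norm_mul, Complex.norm_real, Complex.norm_real, Real.norm_of_nonneg hκp.le,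
    Real.norm_of_nonneg (by positivity : 0 ≤ κ ^ n)]
  have := norm_add_le (∫ x in (1/4:ℝ)..8, H (κ * s) x) (∫ x in (1/4:ℝ)..8, H (-(κ * s)) x)
  have h1 := hHb (κ * s)
  have h2 := hHb (-(κ * s))
  calc _ ≤ κ * (κ ^ n * (2 * (K * A * min 1 (1 / √|T|)))) := by gcongr; linarith
    _ = _ := by ring

/-- Decay estimate for the frequency-localized fractional Schrödinger kernel
(`φ(r) = r^α`, `0 < α < 1`): `|F_j^φ(t,z,s)| ≤ C |t|^{-θ/2} 2^{j(N-αθ)}` for all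
`j ∈ ℤ`, `t ≠ 0`, `θ ∈ [0,1]`, where `N = 2n+2`. -/
theorem statement13 (n : ℕ) (hn : 1 ≤ n) (α : ℝ) (hα0 : 0 < α) (hα1 : α < 1)
    (R : ℝ → ℝ) (hRsm : ContDiff ℝ (⊤ : ℕ∞) R) (hRcs : HasCompactSupport R)
    (hRev : ∀ τ, R (-τ) = R τ) (hRpos : ∀ τ, 0 ≤ R τ)
    (hRsupp : ∀ τ, R τ ≠ 0 → 1 / 2 ≤ |τ| ∧ |τ| ≤ 4)
    (hRsum : ∀ τ : ℝ, τ ≠ 0 → HasSum (fun j : ℤ => R ((2 : ℝ) ^ (-(2 : ℤ) * j) * τ)) 1) :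
    ∃ C : ℝ, 0 < C ∧ ∀ j : ℤ, ∀ t : ℝ, t ≠ 0 →
      ∀ θ : ℝ, θ ∈ Set.Icc (0 : ℝ) 1 → ∀ (z : Fin n → ℂ) (s : ℝ),
      ‖Fkernel n R (fun r => r ^ α) j t z s‖ ≤
        C * |t| ^ (-(θ / 2)) * (2 : ℝ) ^ ((j : ℝ) * ((2 * (n : ℝ) + 2) - α * θ)) := by
  obtain ⟨K, hK, hb⟩ := fterm_bound n hn α hα0 hα1 R hRsm hRev hRsupp
  have hsum : Summable fun m : ℕ => ((m:ℝ) + 1) ^ (-(3/2) : ℝ) := by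
    have := (summable_nat_add_iff 1).2 (Real.summable_nat_rpow.2 (by norm_num : (-(3/2) : ℝ) < -1))
    simpa using this
  set S : ℝ := ∑' m : ℕ, ((m:ℝ) + 1) ^ (-(3/2) : ℝ) with hS
  have hS0 : 0 ≤ S := tsum_nonneg fun m => by positivity
  set P : ℝ := (2 : ℝ) ^ (n - 1) / Real.pi ^ (n + 1) with hP
  have hP0 : 0 < P := by positivity
  refine ⟨P * (34 * K * (S + 1)), by positivity, ?_⟩
  intro j t ht θ hθ z s
  have htp : 0 < |t| := abs_pos.2 ht
  set D : ℝ := |t| ^ (-(θ / 2)) * (2 : ℝ) ^ ((j : ℝ) * ((2 * (n : ℝ) + 2) - α * θ)) with hD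
  have hD0 : 0 < D := by positivity
  set E : ℝ := (2:ℝ) ^ (2 * j) with hE
  have hEp : 0 < E := by positivity
  have hE2 : E = (2:ℝ) ^ (2 * (j:ℝ)) := by
    rw [hE, ← Real.rpow_intCast]; push_cast; rfl
  have hmin : E ^ (n + 1) * min 1 (1 / √|t * (4 * E) ^ α|) ≤ D := by
    set τ : ℝ := |t| * E ^ α with hτ
    have hτp : 0 < τ := by positivity
    have h1 : τ ≤ |t * (4 * E) ^ α| := by
      rw [abs_mul, abs_of_pos (by positivity : 0 < (4 * E) ^ α)]
      rw [hτ]; gcongr; linarith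
    have h2 : min 1 (1 / √|t * (4 * E) ^ α|) ≤ min 1 (τ ^ (-(1/2) : ℝ)) := by
      refine min_le_min_left 1 ?_
      rw [Real.rpow_neg hτp.le, ← Real.sqrt_eq_rpow, ← one_div]
      gcongr
    have h3 : min 1 (τ ^ (-(1/2) : ℝ)) ≤ τ ^ (-(θ/2)) := by
      rcases le_total 1 τ with h | h
      · exact (min_le_right _ _).trans (Real.rpow_le_rpow_of_exponent_le h (by linarith [hθ.2]))
      · exact (min_le_left _ _).trans (Real.one_le_rpow_of_pos_of_le_one_of_nonpos hτp h (by linarith [hθ.1]))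
    have h4 : E ^ (n + 1) * τ ^ (-(θ/2)) = D := by
      rw [hD, hτ, Real.mul_rpow htp.le (by positivity), ← Real.rpow_mul hEp.le, ← Real.rpow_natCast E, mul_left_comm,
        ← Real.rpow_add hEp, hE2, ← Real.rpow_mul (by norm_num)]
      congr 2
      push_cast; ring
    calc _ ≤ E ^ (n + 1) * τ ^ (-(θ/2)) := by gcongr; exact h2.trans h3
      _ = D := h4
  have hterm : ∀ m : ℕ, ‖Fterm n R (fun r => r ^ α) j t z s m‖ ≤ (34 * K * D) * ((m:ℝ) + 1) ^ (-(3/2) : ℝ) := by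
    intro m
    refine (hb j t ht z s m).trans ?_
    have hn' : (1:ℝ) ≤ n := by exact_mod_cast hn
    set M : ℝ := 2 * (m:ℝ) + n with hM
    have hm1 : (0:ℝ) < (m:ℝ) + 1 := by positivity
    have hMm : (m:ℝ) + 1 ≤ M := by rw [hM]; have : (0:ℝ) ≤ m := by positivity
                                   linarith
    have hMp : 0 < M := by positivity
    have hA : ((m:ℝ) + 1) ^ (n - 1) * √(2 * m + 1) / M ^ (n + 1) ≤ 2 * ((m:ℝ) + 1) ^ (-(3/2) : ℝ) := by
      have q1 : √(2 * (m:ℝ) + 1) ≤ 2 * √((m:ℝ) + 1) := by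
        rw [Real.sqrt_le_left (by positivity), mul_pow, Real.sq_sqrt hm1.le]; linarith
      have q2 : ((m:ℝ) + 1) ^ (-(3/2) : ℝ) = √((m:ℝ) + 1) / ((m:ℝ) + 1) ^ 2 := by
        rw [Real.sqrt_eq_rpow, ← Real.rpow_natCast ((m:ℝ)+1) 2, ← Real.rpow_sub hm1]; norm_num
      have q3 : ((m:ℝ) + 1) ^ (n + 1) = ((m:ℝ) + 1) ^ (n - 1) * ((m:ℝ) + 1) ^ 2 := by
        rw [← pow_add]; congr 1; omega
      calc _ ≤ ((m:ℝ) + 1) ^ (n - 1) * (2 * √((m:ℝ) + 1)) / ((m:ℝ) + 1) ^ (n + 1) := by gcongr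
        _ = _ := by rw [q2, q3]; field_simp
    calc _ = 17 * K * (E ^ (n + 1) * min 1 (1 / √|t * (4 * E) ^ α|)) *
          (((m:ℝ) + 1) ^ (n - 1) * √(2 * m + 1) / M ^ (n + 1)) := by
          rw [div_pow]; ring
      _ ≤ 17 * K * D * (2 * ((m:ℝ) + 1) ^ (-(3/2) : ℝ)) := by gcongr
      _ = _ := by ring
  unfold Fkernel
  rw [norm_mul, Complex.norm_real, Real.norm_of_nonneg hP0.le]
  have := tsum_of_norm_bounded ((hsum.hasSum).mul_left (34 * K * D)) hterm
  calc _ ≤ P * (34 * K * D * S) := by gcongr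
    _ ≤ P * (34 * K * D * (S + 1)) := by gcongr; linarith
    _ = _ := by rw [hD]; ring
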